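/- For every linear code C of length n over R, the Gray image of the dual equals the dual of the Gray image: Ψ(C^⊥) = Ψ(C)^⊥ in F_q^{3n}. -/

import Mathlib

open Polynomial

/-- The ring `R = F_q[v]/(v³ - v)`, where `v` is the image of `X`. -/
abbrev Rv (F : Type) [Field F] : Type := AdjoinRoot (X ^ 3 - X : F[X])

lemma monicV (F : Type) [Field F] : (X ^ 3 - X : F[X]).Monic :=
  Polynomial.monic_X_pow_sub (by simp)

/-- The `i`-th coefficient of the canonical representation `a₀ + a₁ v + a₂ v²`
of an element of `R`. -/
noncomputable def coefR (F : Type) [Field F] (i : ℕ) (x : Rv F) : F :=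
  (AdjoinRoot.modByMonicHom (monicV F) x).coeff i

/-- The Gray map `Ψ : Rⁿ → F_q^{3n}`, sending each coordinate
`a₀ + a₁ v + a₂ v²` to the triple `(a₀, a₀ + a₂, a₁)`. -/
noncomputable def gray (F : Type) [Field F] {n : ℕ} (x : Fin n → Rv F) :
    Fin n × Fin 3 → F :=
  fun p => ![coefR F 0 (x p.1), coefR F 0 (x p.1) + coefR F 2 (x p.1), coefR F 1 (x p.1)] p.2

/-- The dual of a code with respect to the Euclidean inner product `x·y = Σᵢ xᵢ yᵢ`. -/
def dualSet {A : Type} [CommRing A] {ι : Type} [Fintype ι] (C : Set (ι → A)) :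
    Set (ι → A) :=
  {x | ∀ c ∈ C, ∑ i, x i * c i = 0}

/-- Hamming weight: the number of nonzero coordinates. -/
noncomputable def hWt {A : Type} [Zero A] {ι : Type} [Fintype ι] (x : ι → A) : ℕ :=
  Nat.card {i // x i ≠ 0}

/-- Lee weight: the Hamming weight of the Gray image. -/
noncomputable def leeWt (F : Type) [Field F] {n : ℕ} (x : Fin n → Rv F) : ℕ :=
  hWt (gray F x)

/-- The cyclic (right) shift `(c₀, …, c_{n-1}) ↦ (c_{n-1}, c₀, …, c_{n-2})`. -/
def rshift {A : Type} {n : ℕ} (x : Fin n → A) : Fin n → A :=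
  fun i => x ((finRotate n).symm i)

/-- A code is cyclic if it is closed under the cyclic shift. -/
def IsCyclicCode {A : Type} {n : ℕ} (C : Set (Fin n → A)) : Prop :=
  ∀ x ∈ C, rshift x ∈ C

/-- The element `a + b v + c v²` of `R`. -/
noncomputable def ofCoeffs (F : Type) [Field F] (a b c : F) : Rv F :=
  AdjoinRoot.mk _ (C a + C b * X + C c * X ^ 2)

lemma degree_quadratic_lt (F : Type) [Field F] (a b c : F) :
    (C a + C b * X + C c * X ^ 2 : F[X]).degree < (X ^ 3 - X : F[X]).degree := by
  have h : (X ^ 3 - X : F[X]).degree = 3 := by compute_degree!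
  rw [h]
  refine lt_of_le_of_lt (b := 2) (by compute_degree) (by norm_num)

lemma modByMonicHom_ofCoeffs (F : Type) [Field F] (a b c : F) :
    AdjoinRoot.modByMonicHom (monicV F) (ofCoeffs F a b c) = C a + C b * X + C c * X ^ 2 := by
  rw [ofCoeffs, AdjoinRoot.modByMonicHom_mk,
    (Polynomial.modByMonic_eq_self_iff (monicV F)).2 (degree_quadratic_lt F a b c)]

lemma coefR_zero_ofCoeffs (F : Type) [Field F] (a b c : F) :
    coefR F 0 (ofCoeffs F a b c) = a := by
  simp [coefR, modByMonicHom_ofCoeffs]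

lemma coefR_one_ofCoeffs (F : Type) [Field F] (a b c : F) :
    coefR F 1 (ofCoeffs F a b c) = b := by
  simp [coefR, modByMonicHom_ofCoeffs, coeff_C]

lemma coefR_two_ofCoeffs (F : Type) [Field F] (a b c : F) :
    coefR F 2 (ofCoeffs F a b c) = c := by
  simp [coefR, modByMonicHom_ofCoeffs]

lemma ofCoeffs_coefR (F : Type) [Field F] (x : Rv F) :
    ofCoeffs F (coefR F 0 x) (coefR F 1 x) (coefR F 2 x) = x := by
  have hlt : (AdjoinRoot.modByMonicHom (monicV F) x).degree < (3 : ℕ) := by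
    obtain ⟨p, rfl⟩ := AdjoinRoot.mk_surjective x
    rw [AdjoinRoot.modByMonicHom_mk]
    have h : (X ^ 3 - X : F[X]).degree = (3 : ℕ) := by compute_degree!
    exact h ▸ degree_modByMonic_lt p (monicV F)
  conv_rhs => rw [← AdjoinRoot.mk_leftInverse (monicV F) x]
  rw [ofCoeffs]
  congr 1
  ext i
  rcases i with _ | _ | _ | i
  · simp [coefR]
  · simp [coefR, coeff_C]
  · simp [coefR]
  · rw [coeff_eq_zero_of_degree_lt
      (hlt.trans_le (by exact_mod_cast (by omega : 3 ≤ i + 1 + 1 + 1)))]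
    simp

lemma ofCoeffs_mul (F : Type) [Field F] (a b c a' b' c' : F) :
    ofCoeffs F a b c * ofCoeffs F a' b' c' =
      ofCoeffs F (a * a') (a * b' + b * a' + b * c' + c * b')
        (a * c' + b * b' + c * a' + c * c') := by
  simp only [ofCoeffs, ← map_mul]
  rw [AdjoinRoot.mk_eq_mk]
  refine ⟨C (b * c' + c * b') + C (c * c') * X, ?_⟩
  simp only [C_add, C_mul]
  ring

/-- The linear functional `a + b v + c v² ↦ 2a + c` on `R`. -/
noncomputable def traceForm (F : Type) [Field F] : Rv F →ₗ[F] F :=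
  (2 • lcoeff F 0 + lcoeff F 2) ∘ₗ AdjoinRoot.modByMonicHom (monicV F)

lemma traceForm_apply (F : Type) [Field F] (x : Rv F) :
    traceForm F x = 2 * coefR F 0 x + coefR F 2 x := by
  simp [traceForm, coefR]

lemma sum_gray_mul_gray (F : Type) [Field F] {n : ℕ} (x y : Fin n → Rv F) :
    ∑ p, gray F x p * gray F y p = traceForm F (∑ i, x i * y i) := by
  rw [Fintype.sum_prod_type, map_sum]
  refine Finset.sum_congr rfl fun i _ => ?_
  rw [traceForm_apply, ← ofCoeffs_coefR F (x i), ← ofCoeffs_coefR F (y i), ofCoeffs_mul,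
    coefR_zero_ofCoeffs, coefR_two_ofCoeffs]
  simp only [gray, Fin.sum_univ_three, Matrix.cons_val]
  ring

lemma eq_zero_of_traceForm_mul_eq_zero (F : Type) [Field F] {x : Rv F}
    (h : ∀ r, traceForm F (r * x) = 0) : x = 0 := by
  have key (a b c : F) := h (ofCoeffs F a b c)
  rw [← ofCoeffs_coefR F x] at key ⊢
  simp only [ofCoeffs_mul, traceForm_apply, coefR_zero_ofCoeffs, coefR_two_ofCoeffs] at key
  have h0 := key 1 0 0
  have h1 := key 0 1 0
  have h2 := key 0 0 1
  have e1 : coefR F 1 x = 0 := by linear_combination h1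
  have e0 : coefR F 0 x = 0 := by linear_combination h0 - h2
  have e2 : coefR F 2 x = 0 := by linear_combination 2 * h2 - h0
  simp [e0, e1, e2, ofCoeffs]

lemma gray_surjective (F : Type) [Field F] (n : ℕ) :
    Function.Surjective (gray F (n := n)) := by
  intro y
  refine ⟨fun i => ofCoeffs F (y (i, 0)) (y (i, 2)) (y (i, 1) - y (i, 0)), ?_⟩
  ext ⟨i, j⟩
  fin_cases j <;>
    simp [gray, coefR_zero_ofCoeffs, coefR_one_ofCoeffs, coefR_two_ofCoeffs]

/-- for every linear code `C ⊆ Rⁿ`, the Gray image of the dual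
equals the dual of the Gray image: `Ψ(C^⊥) = Ψ(C)^⊥`. -/
theorem gray_image_dual (F : Type) [Field F] [Finite F] (n : ℕ)
    (C : Submodule (Rv F) (Fin n → Rv F)) :
    gray F '' dualSet (C : Set (Fin n → Rv F)) = dualSet (gray F '' (C : Set (Fin n → Rv F))) := by
  ext y
  obtain ⟨x, rfl⟩ := gray_surjective F n y
  constructor
  · rintro ⟨z, hz, hzx⟩
    rw [← hzx]
    rintro _ ⟨c, hc, rfl⟩
    rw [sum_gray_mul_gray, hz c hc, map_zero]
  · refine fun hx => ⟨x, fun c hc => eq_zero_of_traceForm_mul_eq_zero F fun r => ?_, rfl⟩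
    have h := hx _ ⟨r • c, C.smul_mem r hc, rfl⟩
    rw [sum_gray_mul_gray] at h
    simpa [Finset.mul_sum, mul_left_comm] using h
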